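/- (Key deterministic matrix inequality, multi-dimensional case.) Let H, d_x, d_u ≥ 1, let κ ≥ 1 and 0 < γ < 1, let B be a d_x×d_u real matrix and K a d_u×d_x real matrix with ‖K‖ ≤ κ. Let G and G' be symmetric positive semidefinite real matrices of size Hd_x×Hd_x with G ⪰ (1/(4κ⁴)) I, and let Y be an Hd_x×Hd_x real matrix with ‖Y‖ ≤ κ²/γ. Set C := (I_H ⊗ K) Y (I_H ⊗ B) and F := (I_H ⊗ B)ᵀ G' (I_H ⊗ B) − C − Cᵀ + I_{Hd_u}. If F is positive semidefinite, then F + (I_H ⊗ B)ᵀ G (I_H ⊗ B) ⪰ (γ²/(36 κ^{10})) I_{Hd_u}, i.e., mᵀ(F + (I_H ⊗ B)ᵀ G (I_H ⊗ B))m ≥ (γ²/(36 κ^{10}))‖m‖² for every m ∈ ℝ^{Hd_u}. -/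

import Mathlib

open Matrix Finset Kronecker

/-- The ℓ² operator (spectral) norm of a matrix. -/
noncomputable def specNorm {𝕜 : Type*} [RCLike 𝕜] {m n : Type*} [Fintype m] [Fintype n]
    [DecidableEq n] (A : Matrix m n 𝕜) : ℝ :=
  ‖LinearMap.toContinuousLinearMap (Matrix.toEuclideanLin A)‖

lemma mulVec_dotProduct_mulVec_le_of_specNorm_le {m n : Type*} [Fintype m] [Fintype n]
    [DecidableEq n] {A : Matrix m n ℝ} {c : ℝ} (h : specNorm A ≤ c) (x : n → ℝ) :
    (A *ᵥ x) ⬝ᵥ (A *ᵥ x) ≤ c ^ 2 * (x ⬝ᵥ x) := by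
  have key : ‖WithLp.toLp 2 (A *ᵥ x)‖ ≤ c * ‖WithLp.toLp 2 x‖ := by
    have h₁ := (LinearMap.toContinuousLinearMap (Matrix.toEuclideanLin A)).le_of_opNorm_le h
      (WithLp.toLp 2 x)
    simpa using h₁
  have h₂ := pow_le_pow_left₀ (norm_nonneg _) key 2
  rw [mul_pow, EuclideanSpace.real_norm_sq_eq, EuclideanSpace.real_norm_sq_eq] at h₂
  simpa [dotProduct, sq] using h₂

lemma one_kronecker_mulVec {l m n : Type*} [Fintype l] [DecidableEq l] [Fintype n]
    (A : Matrix m n ℝ) (x : l × n → ℝ) (i : l) (j : m) :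
    (((1 : Matrix l l ℝ) ⊗ₖ A) *ᵥ x) (i, j) = (A *ᵥ fun k => x (i, k)) j := by
  simp [mulVec, dotProduct, Fintype.sum_prod_type, one_apply, ite_mul]

lemma one_kronecker_mulVec_dotProduct_le_of_specNorm_le {l m n : Type*} [Fintype l]
    [DecidableEq l] [Fintype m] [Fintype n] [DecidableEq n] {A : Matrix m n ℝ} {c : ℝ}
    (h : specNorm A ≤ c) (x : l × n → ℝ) :
    (((1 : Matrix l l ℝ) ⊗ₖ A) *ᵥ x) ⬝ᵥ (((1 : Matrix l l ℝ) ⊗ₖ A) *ᵥ x) ≤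
      c ^ 2 * (x ⬝ᵥ x) := by
  simp only [dotProduct, Fintype.sum_prod_type, one_kronecker_mulVec, Finset.mul_sum (s := univ)
    (f := fun i => ∑ j, x (i, j) * x (i, j))]
  exact Finset.sum_le_sum fun i _ =>
    mulVec_dotProduct_mulVec_le_of_specNorm_le h fun k => x (i, k)

lemma dotProduct_transpose_mul_mul_mulVec {m n : Type*} [Fintype m] [Fintype n]
    (A : Matrix m n ℝ) (G : Matrix m m ℝ) (x : n → ℝ) :
    x ⬝ᵥ ((Aᵀ * G * A) *ᵥ x) = (A *ᵥ x) ⬝ᵥ (G *ᵥ (A *ᵥ x)) := by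
  rw [← mulVec_mulVec, ← mulVec_mulVec, dotProduct_mulVec x Aᵀ, vecMul_transpose]

lemma dotProduct_mulVec_sq_le_of_specNorm_le {l m n p : Type*} [Fintype l] [DecidableEq l]
    [Fintype m] [Fintype n] [DecidableEq n] [Fintype p] [DecidableEq p]
    {K : Matrix m n ℝ} {Y : Matrix (l × n) p ℝ} {a b : ℝ}
    (hK : specNorm K ≤ a) (hY : specNorm Y ≤ b) (x : l × m → ℝ) (y : p → ℝ) :
    (x ⬝ᵥ (((1 : Matrix l l ℝ) ⊗ₖ K) *ᵥ (Y *ᵥ y))) ^ 2 ≤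
      (a * b) ^ 2 * ((x ⬝ᵥ x) * (y ⬝ᵥ y)) := by
  set z := ((1 : Matrix l l ℝ) ⊗ₖ K) *ᵥ (Y *ᵥ y)
  have hcs : (x ⬝ᵥ z) ^ 2 ≤ (x ⬝ᵥ x) * (z ⬝ᵥ z) := by
    simpa only [dotProduct, sq] using Finset.sum_mul_sq_le_sq_mul_sq univ x z
  have hz₁ : z ⬝ᵥ z ≤ a ^ 2 * (b ^ 2 * (y ⬝ᵥ y)) :=
    (one_kronecker_mulVec_dotProduct_le_of_specNorm_le hK _).trans <|
      mul_le_mul_of_nonneg_left (mulVec_dotProduct_mulVec_le_of_specNorm_le hY y) (sq_nonneg a)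
  have hx : 0 ≤ x ⬝ᵥ x := Finset.sum_nonneg fun i _ => mul_self_nonneg (x i)
  calc (x ⬝ᵥ z) ^ 2 ≤ (x ⬝ᵥ x) * (a ^ 2 * (b ^ 2 * (y ⬝ᵥ y))) :=
        hcs.trans (mul_le_mul_of_nonneg_left hz₁ hx)
    _ = (a * b) ^ 2 * ((x ⬝ᵥ x) * (y ⬝ᵥ y)) := by ring

lemma mul_le_of_quadratic_bounds {κ γ a p q g g' : ℝ} (hκ : 1 ≤ κ) (hγ0 : 0 < γ) (hγ1 : γ < 1)
    (ha : 0 ≤ a) (hg' : 0 ≤ g') (hp : 0 ≤ p) (hg : 1 / (4 * κ ^ 4) * p ≤ g)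
    (hq : q ^ 2 ≤ (κ * (κ ^ 2 / γ)) ^ 2 * (a * p)) (hf : 0 ≤ g' - 2 * q + a) :
    γ ^ 2 / (36 * κ ^ 10) * a ≤ g' - 2 * q + a + g := by
  have hκ0 : 0 < κ := by linarith
  rcases le_total (γ ^ 2 / (9 * κ ^ 6) * a) p with h | h
  · have h₁ : 1 / (4 * κ ^ 4) * (γ ^ 2 / (9 * κ ^ 6) * a) ≤ 1 / (4 * κ ^ 4) * p := by gcongr
    have h₂ : 1 / (4 * κ ^ 4) * (γ ^ 2 / (9 * κ ^ 6) * a) = γ ^ 2 / (36 * κ ^ 10) * a := by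
      field_simp
      ring
    linarith
  · have h₁ : q ^ 2 ≤ (a / 3) ^ 2 := calc
      q ^ 2 ≤ (κ * (κ ^ 2 / γ)) ^ 2 * (a * (γ ^ 2 / (9 * κ ^ 6) * a)) := hq.trans (by gcongr)
      _ = (a / 3) ^ 2 := by
        field_simp
        norm_num
    have h₂ : q ≤ a / 3 := le_of_abs_le (abs_le_of_sq_le_sq h₁ (by positivity))
    have h₃ : γ ^ 2 / (36 * κ ^ 10) ≤ 1 / 3 := by
      rw [div_le_div_iff₀ (by positivity) (by norm_num)]
      nlinarith [one_le_pow₀ hκ (n := 10), pow_le_one₀ hγ0.le hγ1.le (n := 2)]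
    have h₄ : 0 ≤ 1 / (4 * κ ^ 4) * p := by positivity
    nlinarith [mul_le_mul_of_nonneg_right h₃ ha]

/-- **Key deterministic matrix inequality, multi-dimensional case**: if `F ⪰ 0` then
`F + (I_H ⊗ B)ᵀ G (I_H ⊗ B) ⪰ (γ²/(36κ¹⁰)) I`. -/
theorem key_matrix_inequality_multidim
    (H dx du : ℕ) (hH : 1 ≤ H) (hdx : 1 ≤ dx) (hdu : 1 ≤ du)
    (κ γ : ℝ) (hκ : 1 ≤ κ) (hγ0 : 0 < γ) (hγ1 : γ < 1)
    (B : Matrix (Fin dx) (Fin du) ℝ) (K : Matrix (Fin du) (Fin dx) ℝ)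
    (hK : specNorm K ≤ κ)
    (G G' : Matrix (Fin H × Fin dx) (Fin H × Fin dx) ℝ)
    (hG : G.PosSemidef) (hG' : G'.PosSemidef)
    (hGlb : (G - (1 / (4 * κ ^ 4)) •
      (1 : Matrix (Fin H × Fin dx) (Fin H × Fin dx) ℝ)).PosSemidef)
    (Y : Matrix (Fin H × Fin dx) (Fin H × Fin dx) ℝ)
    (hY : specNorm Y ≤ κ ^ 2 / γ)
    (C : Matrix (Fin H × Fin du) (Fin H × Fin du) ℝ)
    (hC : C = ((1 : Matrix (Fin H) (Fin H) ℝ) ⊗ₖ K) * Y * ((1 : Matrix (Fin H) (Fin H) ℝ) ⊗ₖ B))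
    (F : Matrix (Fin H × Fin du) (Fin H × Fin du) ℝ)
    (hF : F = ((1 : Matrix (Fin H) (Fin H) ℝ) ⊗ₖ B)ᵀ * G' *
        ((1 : Matrix (Fin H) (Fin H) ℝ) ⊗ₖ B) - C - Cᵀ + 1)
    (hFpsd : F.PosSemidef) :
    (F + ((1 : Matrix (Fin H) (Fin H) ℝ) ⊗ₖ B)ᵀ * G * ((1 : Matrix (Fin H) (Fin H) ℝ) ⊗ₖ B) -
      (γ ^ 2 / (36 * κ ^ 10)) • (1 : Matrix (Fin H × Fin du) (Fin H × Fin du) ℝ)).PosSemidef := by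
  have hGt : Gᵀ = G := by simpa [IsHermitian] using hG.isHermitian
  have hFt : Fᵀ = F := by simpa [IsHermitian] using hFpsd.isHermitian
  refine PosSemidef.of_dotProduct_mulVec_nonneg ?_ fun m => ?_
  · simp [IsHermitian, conjTranspose_eq_transpose_of_trivial, hGt, hFt, Matrix.mul_assoc]
  · set Bm := ((1 : Matrix (Fin H) (Fin H) ℝ) ⊗ₖ B) *ᵥ m
    have hCm : m ⬝ᵥ (C *ᵥ m) =
        m ⬝ᵥ (((1 : Matrix (Fin H) (Fin H) ℝ) ⊗ₖ K) *ᵥ (Y *ᵥ Bm)) := by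
      rw [hC, ← mulVec_mulVec, ← mulVec_mulVec]
    have hFm : m ⬝ᵥ (F *ᵥ m) = Bm ⬝ᵥ (G' *ᵥ Bm) - 2 * (m ⬝ᵥ (C *ᵥ m)) + m ⬝ᵥ m := by
      have hCt : m ⬝ᵥ (Cᵀ *ᵥ m) = m ⬝ᵥ (C *ᵥ m) := by
        rw [dotProduct_mulVec, vecMul_transpose, dotProduct_comm]
      rw [hF, add_mulVec, sub_mulVec, sub_mulVec, one_mulVec, dotProduct_add, dotProduct_sub,
        dotProduct_sub, dotProduct_transpose_mul_mul_mulVec, hCt]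
      ring
    have hFm0 : 0 ≤ m ⬝ᵥ (F *ᵥ m) := by simpa using hFpsd.dotProduct_mulVec_nonneg m
    have hG'm : 0 ≤ Bm ⬝ᵥ (G' *ᵥ Bm) := by simpa using hG'.dotProduct_mulVec_nonneg Bm
    have hGm : 1 / (4 * κ ^ 4) * (Bm ⬝ᵥ Bm) ≤ Bm ⬝ᵥ (G *ᵥ Bm) := by
      have h := hGlb.dotProduct_mulVec_nonneg Bm
      rw [star_trivial, sub_mulVec, smul_mulVec, one_mulVec, dotProduct_sub, dotProduct_smul,
        smul_eq_mul] at h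
      linarith
    have hq := dotProduct_mulVec_sq_le_of_specNorm_le hK hY m Bm
    rw [← hCm] at hq
    have hself {ι : Type} [Fintype ι] (x : ι → ℝ) : 0 ≤ x ⬝ᵥ x :=
      Finset.sum_nonneg fun i _ => mul_self_nonneg (x i)
    have main := mul_le_of_quadratic_bounds hκ hγ0 hγ1 (hself m) hG'm (hself Bm) hGm hq
      (hFm ▸ hFm0)
    rw [star_trivial, sub_mulVec, add_mulVec, smul_mulVec, one_mulVec, dotProduct_sub,
      dotProduct_add, dotProduct_smul, smul_eq_mul, dotProduct_transpose_mul_mul_mulVec, hFm]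
    linarith
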